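/- Fix r₀ > 0 and C > 0. On the open set of points (x,y,z) ∈ ℝ³ with r > 0, 0 < Ψ, (r−r₀)² + z² > 0, and C − 2Ψ² > 0, where r = √(x²+y²), Ψ = (1/2)[(r−r₀)² + z²], ϑ = arctan(z/(r−r₀)) is the poloidal angle with gradient ∇ϑ = [(r−r₀)∇z − z∇r]/[(r−r₀)²+z²], and φ is the toroidal angle, let g : ℝ → ℝ be a continuously differentiable 2π-periodic function and define w = √(C − 2Ψ²) ∇ϑ + g(φ) ∇φ. Then (∇×w)×w = ∇Ψ on this set. (This w is in general not solenoidal, illustrating that dropping the constraint ∇·w = 0 permits explicit solutions of the force-balance equation (∇×w)×w = ∇Ψ.) -/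

import Mathlib

/-- Partial derivative of a scalar field on `ℝ³` in the `i`-th coordinate direction. -/
noncomputable def pd (i : Fin 3) (f : (Fin 3 → ℝ) → ℝ) (x : Fin 3 → ℝ) : ℝ :=
  fderiv ℝ f x (Pi.single i 1)

/-- Gradient of a scalar field on `ℝ³`. -/
noncomputable def grad (f : (Fin 3 → ℝ) → ℝ) (x : Fin 3 → ℝ) : Fin 3 → ℝ :=
  ![pd 0 f x, pd 1 f x, pd 2 f x]

/-- Divergence of a vector field on `ℝ³`. -/
noncomputable def div3 (w : (Fin 3 → ℝ) → (Fin 3 → ℝ)) (x : Fin 3 → ℝ) : ℝ :=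
  pd 0 (fun y => w y 0) x + pd 1 (fun y => w y 1) x + pd 2 (fun y => w y 2) x

/-- Curl of a vector field on `ℝ³`. -/
noncomputable def curl (w : (Fin 3 → ℝ) → (Fin 3 → ℝ)) (x : Fin 3 → ℝ) : Fin 3 → ℝ :=
  ![pd 1 (fun y => w y 2) x - pd 2 (fun y => w y 1) x,
    pd 2 (fun y => w y 0) x - pd 0 (fun y => w y 2) x,
    pd 0 (fun y => w y 1) x - pd 1 (fun y => w y 0) x]

/-- Cross product on `ℝ³`. -/
def cross3 (u v : Fin 3 → ℝ) : Fin 3 → ℝ :=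
  ![u 1 * v 2 - u 2 * v 1, u 2 * v 0 - u 0 * v 2, u 0 * v 1 - u 1 * v 0]

/-- Dot product on `ℝ³`. -/
def dot3 (u v : Fin 3 → ℝ) : ℝ := u 0 * v 0 + u 1 * v 1 + u 2 * v 2

open scoped Real

/-- The cylindrical radius `r = √(x² + y²)`. -/
noncomputable def cylR (p : Fin 3 → ℝ) : ℝ := Real.sqrt (p 0 ^ 2 + p 1 ^ 2)

/-- The azimuthal angle `φ` of a point of `ℝ³`. -/
noncomputable def cylφ (p : Fin 3 → ℝ) : ℝ := Complex.arg ((p 0 : ℂ) + (p 1 : ℂ) * Complex.I)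

theorem hasFDerivAt_coord (i : Fin 3) (p : Fin 3 → ℝ) :
    HasFDerivAt (fun q : Fin 3 → ℝ => q i)
      (ContinuousLinearMap.proj i : (Fin 3 → ℝ) →L[ℝ] ℝ) p :=
  (ContinuousLinearMap.proj i : (Fin 3 → ℝ) →L[ℝ] ℝ).hasFDerivAt

theorem hasFDerivAt_cylR {p : Fin 3 → ℝ} (hp : 0 < cylR p) :
    HasFDerivAt cylR ((p 0 / cylR p) • (ContinuousLinearMap.proj 0 : (Fin 3 → ℝ) →L[ℝ] ℝ) +
      (p 1 / cylR p) • (ContinuousLinearMap.proj 1 : (Fin 3 → ℝ) →L[ℝ] ℝ)) p := by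
  have hpos : 0 < p 0 ^ 2 + p 1 ^ 2 := Real.sqrt_pos.mp hp
  have h0 := hasFDerivAt_coord 0 p
  have h1 := hasFDerivAt_coord 1 p
  have h := ((h0.pow 2).add (h1.pow 2)).sqrt hpos.ne'
  refine h.congr_fderiv ?_
  have hs : √(p 0 ^ 2 + p 1 ^ 2) = cylR p := rfl
  ext v
  simp [hs]
  field_simp

/-- A `2π`-periodic function of the argument is differentiable away from the origin, also across
the branch cut. -/
theorem Function.Periodic.hasFDerivAt_comp_arg {g : ℝ → ℝ} (hper : Function.Periodic g (2 * π))
    {z₀ : ℂ} (hz₀ : z₀ ≠ 0) (hg : DifferentiableAt ℝ g z₀.arg) :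
    HasFDerivAt (fun z : ℂ => g z.arg)
      (deriv g z₀.arg • Complex.imCLM.comp
        ((z₀⁻¹ • (1 : ℂ →L[ℂ] ℂ)).restrictScalars ℝ)) z₀ := by
  have hlog : HasFDerivAt (fun z : ℂ => Complex.log (z / z₀)) (z₀⁻¹ • (1 : ℂ →L[ℂ] ℂ)) z₀ := by
    have h : HasDerivAt (fun z : ℂ => Complex.log (z / z₀)) (1 / z₀ / (z₀ / z₀)) z₀ :=
      ((hasDerivAt_id z₀).div_const z₀).clog (by simp [div_self hz₀])
    refine h.hasFDerivAt.congr_fderiv ?_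
    ext
    simp [hz₀]
  have harg := (Complex.imCLM.hasFDerivAt.comp z₀ (hlog.restrictScalars ℝ)).const_add z₀.arg
  have hg' : HasDerivAt g (deriv g z₀.arg)
      (z₀.arg + (Complex.imCLM ∘ fun z : ℂ => Complex.log (z / z₀)) z₀) := by
    simpa [div_self hz₀] using hg.hasDerivAt
  refine (hg'.comp_hasFDerivAt z₀ harg).congr_of_eventuallyEq ?_
  filter_upwards [isOpen_ne.mem_nhds hz₀] with z hz
  have hangle : (z.arg : Real.Angle) = ((z₀.arg + (z / z₀).arg : ℝ) : Real.Angle) := by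
    rw [Real.Angle.coe_add, Complex.arg_div_coe_angle hz hz₀]
    abel
  obtain ⟨k, hk⟩ := Real.Angle.angle_eq_iff_two_pi_dvd_sub.mp hangle
  have hk' : z.arg = z₀.arg + (z / z₀).arg + k * (2 * π) := by linarith
  simp only [Function.comp, Complex.imCLM_apply, Complex.log_im]
  rw [hk']
  exact hper.int_mul k _

theorem hasFDerivAt_comp_cylφ {g : ℝ → ℝ} (hper : Function.Periodic g (2 * π))
    {p : Fin 3 → ℝ} (hp : 0 < p 0 ^ 2 + p 1 ^ 2) (hg : DifferentiableAt ℝ g (cylφ p)) :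
    HasFDerivAt (fun q => g (cylφ q)) (deriv g (cylφ p) •
      ((-(p 1) / (p 0 ^ 2 + p 1 ^ 2)) • (ContinuousLinearMap.proj 0 : (Fin 3 → ℝ) →L[ℝ] ℝ) +
      (p 0 / (p 0 ^ 2 + p 1 ^ 2)) • (ContinuousLinearMap.proj 1 : (Fin 3 → ℝ) →L[ℝ] ℝ))) p := by
  have hz : (p 0 : ℂ) + (p 1 : ℂ) * Complex.I ≠ 0 := by
    intro h
    have hre := congrArg Complex.re h
    have him := congrArg Complex.im h
    simp at hre him
    simp [hre, him] at hp
  let L : (Fin 3 → ℝ) →L[ℝ] ℂ :=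
    Complex.ofRealCLM.comp (ContinuousLinearMap.proj 0) +
      (Complex.ofRealCLM.comp (ContinuousLinearMap.proj 1)).smulRight Complex.I
  have hL : HasFDerivAt (fun q : Fin 3 → ℝ => (q 0 : ℂ) + (q 1 : ℂ) * Complex.I) L p :=
    L.hasFDerivAt
  have hg' := hper.hasFDerivAt_comp_arg hz hg
  have h := HasFDerivAt.comp p hg' hL
  refine h.congr_fderiv ?_
  ext v
  simp [L, cylφ, Complex.inv_re, Complex.inv_im, Complex.normSq_apply]
  ring

/-- with `Ψ = (1/2)[(r−r₀)² + z²]`, poloidal-angle gradient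
`∇ϑ = [(r−r₀)∇z − z∇r]/[(r−r₀)² + z²]`, and toroidal-angle gradient `∇φ`, for any `C¹`
`2π`-periodic `g` the (generally non-solenoidal) field `w = √(C − 2Ψ²)∇ϑ + g(φ)∇φ` satisfies
the force-balance equation `(∇×w)×w = ∇Ψ` on the indicated open set. -/
theorem axisymmetric_force_balance_without_solenoidality
    (r₀ C : ℝ) (hr₀ : 0 < r₀) (hC : 0 < C)
    (g : ℝ → ℝ) (hg : ContDiff ℝ 1 g) (hper : Function.Periodic g (2 * π))
    (Ψ : (Fin 3 → ℝ) → ℝ)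
    (hΨ : ∀ p : Fin 3 → ℝ, Ψ p = (1/2) * ((cylR p - r₀) ^ 2 + p 2 ^ 2))
    (Th : (Fin 3 → ℝ) → (Fin 3 → ℝ))
    (hTh : ∀ p : Fin 3 → ℝ, Th p = ((cylR p - r₀) ^ 2 + p 2 ^ 2)⁻¹ •
      ![-(p 2) * p 0 / cylR p, -(p 2) * p 1 / cylR p, cylR p - r₀])
    (Phi : (Fin 3 → ℝ) → (Fin 3 → ℝ))
    (hPhi : ∀ p : Fin 3 → ℝ, Phi p =
      ![-(p 1) / (p 0 ^ 2 + p 1 ^ 2), p 0 / (p 0 ^ 2 + p 1 ^ 2), 0])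
    (w : (Fin 3 → ℝ) → (Fin 3 → ℝ))
    (hw : ∀ p : Fin 3 → ℝ, w p =
      Real.sqrt (C - 2 * Ψ p ^ 2) • Th p + g (cylφ p) • Phi p) :
    ∀ p : Fin 3 → ℝ, 0 < cylR p → 0 < Ψ p → 0 < (cylR p - r₀) ^ 2 + p 2 ^ 2 →
      0 < C - 2 * Ψ p ^ 2 →
      cross3 (curl w p) (w p) = grad Ψ p := by
  intro p hr _ hD hS
  have hρ : 0 < p 0 ^ 2 + p 1 ^ 2 := Real.sqrt_pos.mp hr
  have hr2 : cylR p ^ 2 = p 0 ^ 2 + p 1 ^ 2 := Real.sq_sqrt hρ.le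
  have hx := hasFDerivAt_coord 0 p
  have hy := hasFDerivAt_coord 1 p
  have hz := hasFDerivAt_coord 2 p
  have hR := hasFDerivAt_cylR hr
  have hRinv := (hasDerivAt_inv hr.ne').comp_hasFDerivAt p hR
  have hρinv := (hasDerivAt_inv hρ.ne').comp_hasFDerivAt p ((hx.pow 2).add (hy.pow 2))
  have hG := hasFDerivAt_comp_cylφ hper hρ (hg.differentiable one_ne_zero (cylφ p))
  have hdist := ((hR.sub_const r₀).pow 2).add (hz.pow 2)
  have hΨd : HasFDerivAt Ψ _ p := (hdist.const_mul (1 / 2)).congr_of_eventuallyEq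
    (Filter.Eventually.of_forall hΨ)
  have hK := (((hΨd.pow 2).const_mul 2).const_sub C |>.sqrt hS.ne').mul
    ((hasDerivAt_inv hD.ne').comp_hasFDerivAt p hdist)
  have hw0 := (hK.mul ((hz.neg.mul hx).mul hRinv)).add (hG.mul (hy.neg.mul hρinv))
  have hw1 := (hK.mul ((hz.neg.mul hy).mul hRinv)).add (hG.mul (hx.mul hρinv))
  have hw2 := hK.mul (hR.sub_const r₀)
  replace hw0 := hw0.congr_of_eventuallyEq (f₁ := fun q => w q 0) (Filter.Eventually.of_forall
    fun q => by simp [hw, hTh, hPhi]; ring)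
  replace hw1 := hw1.congr_of_eventuallyEq (f₁ := fun q => w q 1) (Filter.Eventually.of_forall
    fun q => by simp [hw, hTh, hPhi]; ring)
  replace hw2 := hw2.congr_of_eventuallyEq (f₁ := fun q => w q 2) (Filter.Eventually.of_forall
    fun q => by simp [hw, hTh, hPhi]; ring)
  have hcurl : curl w p = (((cylR p - r₀) ^ 2 + p 2 ^ 2) / √(C - 2 * Ψ p ^ 2)) •
      ![-(p 1 / cylR p), p 0 / cylR p, 0] := by
    have hS' : 0 < √(C - 2 * Ψ p ^ 2) := Real.sqrt_pos.mpr hS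
    simp only [curl, pd, hw0.fderiv, hw1.fderiv, hw2.fderiv]
    simp
    generalize √(C - 2 * Ψ p ^ 2) = S at hS' ⊢
    rw [hΨ p]
    refine ⟨?_, ?_, ?_⟩ <;> field_simp <;> ring
  have hgrad : grad Ψ p =
      ![(cylR p - r₀) * (p 0 / cylR p), (cylR p - r₀) * (p 1 / cylR p), p 2] := by
    simp only [grad, pd, hΨd.fderiv]
    simp
    ring_nf
    simp
  have hS' : 0 < √(C - 2 * Ψ p ^ 2) := Real.sqrt_pos.mpr hS
  rw [hcurl, hgrad, hw, hTh, hPhi]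
  simp [cross3]
  generalize √(C - 2 * Ψ p ^ 2) = S at hS' ⊢
  refine ⟨?_, ?_, ?_⟩
  · field_simp
  · field_simp
  · field_simp
    linear_combination (-(p 2 * S * (p 0 ^ 2 + p 1 ^ 2))) * hr2
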